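/- arXiv:math/0611293 — 2 statements merged into one kernel-verified Lean document; each statement's English description precedes it below -/
import Mathlib

section
/- Let a, a', b be integers, each at least 10. Then (a + a') _ b ≥ (a _ b) + (a' _ b). -/
/-- The dungeon operation: interpret the base-10 digits of `a` in base `b`. -/
def dungeon (a b : ℕ) : ℕ := Nat.ofDigits b (Nat.digits 10 a)

theorem dungeon_eq_mod_add (a b : ℕ) :
    dungeon a b = a % 10 + b * dungeon (a / 10) b := by
  rcases Nat.eq_zero_or_pos a with rfl | h
  · simp [dungeon]
  · simp [dungeon, Nat.digits_def' (b := 10) (by norm_num) h, Nat.ofDigits_cons]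

theorem dungeon_succ_le {b : ℕ} (hb : 10 ≤ b) (a : ℕ) :
    dungeon a b + 1 ≤ dungeon (a + 1) b := by
  induction a using Nat.strong_induction_on with
  | _ a ih =>
    rw [dungeon_eq_mod_add a, dungeon_eq_mod_add (a + 1)]
    by_cases h : a % 10 = 9
    · have h₁ : (a + 1) / 10 = a / 10 + 1 := by omega
      have h₂ := Nat.mul_le_mul_left b (ih (a / 10) (by omega))
      rw [mul_add] at h₂
      rw [h₁]
      omega
    · have h₁ : (a + 1) / 10 = a / 10 := by omega
      rw [h₁]
      omega

theorem dungeon_add_left_of_le_base {b : ℕ} (hb : 10 ≤ b) (a a' : ℕ) :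
    dungeon a b + dungeon a' b ≤ dungeon (a + a') b := by
  induction a using Nat.strong_induction_on generalizing a' with
  | _ a ih =>
    rcases Nat.eq_zero_or_pos a with rfl | ha
    · simp [dungeon]
    have h := ih (a / 10) (by omega) (a' / 10)
    rw [dungeon_eq_mod_add a, dungeon_eq_mod_add a', dungeon_eq_mod_add (a + a')]
    by_cases hc : 10 ≤ a % 10 + a' % 10
    · have h₁ : (a + a') / 10 = a / 10 + a' / 10 + 1 := by omega
      have h₂ := Nat.mul_le_mul_left b
        ((Nat.add_le_add_right h 1).trans (dungeon_succ_le hb (a / 10 + a' / 10)))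
      rw [mul_add, mul_add] at h₂
      rw [h₁]
      omega
    · have h₁ : (a + a') / 10 = a / 10 + a' / 10 := by omega
      have h₂ := Nat.mul_le_mul_left b h
      rw [mul_add] at h₂
      rw [h₁]
      omega

theorem dungeon_add_left (a a' b : ℕ) (ha : 10 ≤ a) (ha' : 10 ≤ a') (hb : 10 ≤ b) :
    dungeon a b + dungeon a' b ≤ dungeon (a + a') b := by
  exact dungeon_add_left_of_le_base hb a a'
end

section
/- Let a, b, c be integers, each at least 10, and let k > 10 be a real number such that a ≥ k·b and log c ≥ (log k)/(log k − 1), where log denotes the logarithm to base 10. Then a _ c ≥ k · (c _ b). -/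
open Real

theorem dungeon_eq_mod_add_mul_div (n b : ℕ) (hn : n ≠ 0) :
    dungeon n b = n % 10 + b * dungeon (n / 10) b := by
  unfold dungeon
  rw [Nat.digits_def' (by norm_num) (Nat.pos_of_ne_zero hn), Nat.ofDigits_cons]

/-- Reading `n` in base `b` gives at most `n ^ log b`. -/
theorem dungeon_le_rpow_logb (n b : ℕ) (hb : 10 ≤ b) :
    (dungeon n b : ℝ) ≤ (n : ℝ) ^ logb 10 b := by
  have hb' : (10 : ℝ) ≤ b := by exact_mod_cast hb
  have hs : 1 ≤ logb 10 (b : ℝ) := by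
    rw [Real.le_logb_iff_rpow_le (by norm_num) (by linarith)]
    simpa using hb'
  have hpow : (10 : ℝ) ^ logb 10 (b : ℝ) = b :=
    Real.rpow_logb (by norm_num) (by norm_num) (by linarith)
  induction n using Nat.strong_induction_on with
  | _ n ih =>
    rcases Nat.eq_zero_or_pos n with rfl | hn
    · simp only [dungeon, Nat.digits_zero, Nat.ofDigits_nil, Nat.cast_zero]
      positivity
    · have hq := ih (n / 10) (by omega)
      have hr : ((n % 10 : ℕ) : ℝ) ≤ ((n % 10 : ℕ) : ℝ) ^ logb 10 (b : ℝ) := by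
        rcases Nat.eq_zero_or_pos (n % 10) with h | h
        · rw [h, Nat.cast_zero]
          positivity
        · exact Real.self_le_rpow_of_one_le (by exact_mod_cast h) hs
      have hsum : (n : ℝ) = ((n % 10 : ℕ) : ℝ) + 10 * ((n / 10 : ℕ) : ℝ) := by
        exact_mod_cast (Nat.mod_add_div n 10).symm
      rw [dungeon_eq_mod_add_mul_div n b hn.ne']
      rw [Nat.cast_add, Nat.cast_mul]
      calc ((n % 10 : ℕ) : ℝ) + b * (dungeon (n / 10) b : ℝ)
          ≤ ((n % 10 : ℕ) : ℝ) ^ logb 10 (b : ℝ)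
              + b * ((n / 10 : ℕ) : ℝ) ^ logb 10 (b : ℝ) := by gcongr
        _ = ((n % 10 : ℕ) : ℝ) ^ logb 10 (b : ℝ)
              + (10 * ((n / 10 : ℕ) : ℝ)) ^ logb 10 (b : ℝ) := by
            rw [Real.mul_rpow (by norm_num) (by positivity), hpow]
        _ ≤ (((n % 10 : ℕ) : ℝ) + 10 * ((n / 10 : ℕ) : ℝ)) ^ logb 10 (b : ℝ) :=
            Real.add_rpow_le_rpow_add (by positivity) (by positivity) hs
        _ = (n : ℝ) ^ logb 10 (b : ℝ) := by rw [← hsum]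

/-- The leading digit alone contributes at least `b` to the power of its position. -/
theorem pow_log_le_dungeon (n b : ℕ) (hn : n ≠ 0) : b ^ Nat.log 10 n ≤ dungeon n b := by
  induction n using Nat.strong_induction_on with
  | _ n ih =>
    rw [dungeon_eq_mod_add_mul_div n b hn]
    rcases lt_or_ge n 10 with h | h
    · rw [Nat.log_of_lt h, Nat.mod_eq_of_lt h, pow_zero]
      omega
    · rw [Nat.log_of_one_lt_of_le (by norm_num) h, pow_succ']
      exact le_add_left (Nat.mul_le_mul_left b (ih (n / 10) (by omega) (by omega)))

theorem dungeon_factor_bound (a b c : ℕ) (ha : 10 ≤ a) (hb : 10 ≤ b) (hc : 10 ≤ c)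
    (k : ℝ) (hk : 10 < k) (hab : k * b ≤ (a : ℝ))
    (hc' : logb 10 k / (logb 10 k - 1) ≤ logb 10 c) :
    k * (dungeon c b : ℝ) ≤ (dungeon a c : ℝ) := by
  have hb0 : (0 : ℝ) < b := by exact_mod_cast (by omega : 0 < b)
  have ha0 : (0 : ℝ) < a := by exact_mod_cast (by omega : 0 < a)
  have hc0 : (0 : ℝ) < c := by exact_mod_cast (by omega : 0 < c)
  have hc1 : (1 : ℝ) ≤ c := by exact_mod_cast (by omega : 1 ≤ c)
  have hk0 : 0 < k := by linarith
  have hk1 : 1 < logb 10 k := by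
    rw [Real.lt_logb_iff_rpow_lt (by norm_num) hk0]
    simpa using hk
  have hkc : k ≤ (c : ℝ) ^ (logb 10 k - 1) := by
    rw [← Real.logb_le_logb (b := 10) (by norm_num) hk0 (by positivity),
      Real.logb_rpow_eq_mul_logb_of_pos hc0, mul_comm]
    exact (div_le_iff₀ (by linarith)).mp hc'
  have hlog : logb 10 k + logb 10 b ≤ logb 10 (a : ℝ) := by
    rw [← Real.logb_mul hk0.ne' hb0.ne']
    exact Real.logb_le_logb_of_le (by norm_num) (by positivity) hab
  have hfloor : logb 10 (a : ℝ) ≤ Nat.log 10 a + 1 := by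
    rw [Real.logb_le_iff_le_rpow (by norm_num) ha0]
    exact_mod_cast (Nat.lt_pow_succ_log_self (by norm_num : 1 < 10) a).le
  calc k * (dungeon c b : ℝ)
      ≤ (c : ℝ) ^ (logb 10 k - 1) * (c : ℝ) ^ logb 10 (b : ℝ) := by
        gcongr
        exact dungeon_le_rpow_logb c b hb
    _ = (c : ℝ) ^ (logb 10 k - 1 + logb 10 (b : ℝ)) := (Real.rpow_add hc0 _ _).symm
    _ ≤ (c : ℝ) ^ (Nat.log 10 a : ℝ) :=
        Real.rpow_le_rpow_of_exponent_le hc1 (by linarith)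
    _ = ((c ^ Nat.log 10 a : ℕ) : ℝ) := by rw [Real.rpow_natCast, Nat.cast_pow]
    _ ≤ (dungeon a c : ℝ) := by exact_mod_cast pow_log_le_dungeon a c (by omega)
end
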